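/- Under the hypotheses: there is τ > 0 such that every x ∈ 𝒟 with E_f(x) < τ satisfies (a) x ∈ D, (b) ‖x − T(x)‖ ⪯ γ(E_f(x))·‖W_f(x)‖, (c) ‖W_f(T(x))‖ ⪯ β(E_f(x))·‖W_f(x)‖, with β quasi-homogeneous of degree m ≥ 0 on [0,τ), γ nondecreasing and positive on [0,τ), ψ(t) = 1 − b·t·γ(t) positive on [0,τ), and x⁽⁰⁾ ∈ 𝒟 satisfies E_f(x⁽⁰⁾) < τ and φ(E_f(x⁽⁰⁾)) ≤ 1 where φ = β/ψ: the Picard iterates x⁽ᵏ⁺¹⁾ = T(x⁽ᵏ⁾) converge to a root vector ξ of f and for all k ≥ 0 satisfy ‖x⁽ᵏ⁾ − ξ‖ ⪯ A_k · (θᵏ λ^{S_k(r)} / (1 − θ λ^{rᵏ})) · ‖W_f(x⁽⁰⁾)‖, where r = m + 1, S_k(r) = 1 + r + ⋯ + r^{k−1} (S₀ = 0), λ = φ(E_f(x⁽⁰⁾)), θ = ψ(E_f(x⁽⁰⁾)) and A_k = γ(E_f(x⁽⁰⁾)·λ^{S_k(r)}). (Theorem 2.2 (ii)) -/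

import Mathlib

open Finset Polynomial Filter

noncomputable section

/-- The Weierstrass correction `W_i(x) = f(x_i)/(C₀ ∏_{j≠i}(x_i − x_j))`. -/
def Wc {n : ℕ} {K : Type*} [NormedField K] (f : Polynomial K) (x : Fin n → K) (i : Fin n) : K :=
  eval (x i) f / (f.leadingCoeff * ∏ j ∈ univ.erase i, (x i - x j))

/-- `dmin x i = min_{j ≠ i} ‖x i - x j‖`. -/
def dmin {n : ℕ} {K : Type*} [NormedField K] (x : Fin n → K) (i : Fin n) : ℝ :=
  if h : (univ.erase i).Nonempty then (univ.erase i).inf' h fun j => ‖x i - x j‖ else 0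

/-- `E_f(x)` : the ℓ^p norm of the vector `(‖W_i(x)‖ / d_i(x))_i`. -/
def Ef {n : ℕ} {K : Type*} [NormedField K] (p : ENNReal) (f : Polynomial K)
    (x : Fin n → K) : ℝ :=
  ‖(WithLp.equiv p (Fin n → ℝ)).symm (fun i => ‖Wc f x i‖ / dmin x i)‖

/-- `σ_i(x) = Σ_{j≠i} W_j(x)/(x_i − x_j)`. -/
def sigmaf {n : ℕ} {K : Type*} [NormedField K] (f : Polynomial K) (x : Fin n → K)
    (i : Fin n) : K :=
  ∑ j ∈ univ.erase i, Wc f x j / (x i - x j)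

/-- The Ehrlich iteration function. -/
def PhiE {n : ℕ} {K : Type*} [NormedField K] (f : Polynomial K) (x : Fin n → K) : Fin n → K :=
  fun i => x i - Wc f x i / (1 + sigmaf f x i)

/-- The Prešić–Tanabe iteration function. -/
def TnbE {n : ℕ} {K : Type*} [NormedField K] (f : Polynomial K) (x : Fin n → K) : Fin n → K :=
  fun i => x i - Wc f x i * (1 - sigmaf f x i)

/-- `ξ` is a root vector of `f`, i.e. `f(z) = C₀ ∏ (z − ξᵢ)`. -/
def IsRootVector {n : ℕ} {K : Type*} [NormedField K] (f : Polynomial K) (ξ : Fin n → K) : Prop :=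
  f = C f.leadingCoeff * ∏ i, (X - C (ξ i))

/-- `E_f(x)` in the case `p = ∞`: the max of `‖W_i(x)‖ / d_i(x)`. -/
def Einf {n : ℕ} {K : Type*} [NormedField K] (f : Polynomial K) (x : Fin n → K) : ℝ :=
  if h : (univ : Finset (Fin n)).Nonempty then univ.sup' h fun i => ‖Wc f x i‖ / dmin x i else 0

lemma PiLp.norm_toLp_le_of_le {ι : Type*} [Fintype ι] (p : ENNReal) [Fact (1 ≤ p)]
    {u v : ι → ℝ} (hu : ∀ i, 0 ≤ u i) (huv : ∀ i, u i ≤ v i) :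
    ‖WithLp.toLp p u‖ ≤ ‖WithLp.toLp p v‖ := by
  have hp : 1 ≤ p := Fact.out
  have habs : ∀ i, ‖u i‖ ≤ ‖v i‖ := fun i => by
    rw [Real.norm_of_nonneg (hu i), Real.norm_of_nonneg ((hu i).trans (huv i))]
    exact huv i
  rcases eq_or_ne p ⊤ with rfl | htop
  · rw [PiLp.norm_toLp, PiLp.norm_toLp]
    exact (pi_norm_le_iff_of_nonneg (norm_nonneg v)).2
      fun i => (habs i).trans (norm_le_pi_norm v i)
  · have hp0 : 0 < p.toReal := ENNReal.toReal_pos (by positivity) htop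
    rw [PiLp.norm_eq_sum hp0, PiLp.norm_eq_sum hp0]
    refine Real.rpow_le_rpow (sum_nonneg fun i _ => by positivity) ?_ (by positivity)
    exact sum_le_sum fun i _ => Real.rpow_le_rpow (norm_nonneg _) (habs i) hp0.le

/-- Hölder's inequality for two coordinates. -/
lemma PiLp.add_le_two_rpow_mul_norm {ι : Type*} [Fintype ι] (p q : ENNReal) [Fact (1 ≤ p)]
    (hpq : p⁻¹ + q⁻¹ = 1) {u : ι → ℝ} (hu : ∀ i, 0 ≤ u i) {i j : ι} (hij : i ≠ j) :
    u i + u j ≤ (2 : ℝ) ^ (ENNReal.toReal q⁻¹) * ‖WithLp.toLp p u‖ := by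
  classical
  have hp : 1 ≤ p := Fact.out
  rcases eq_or_ne p ⊤ with rfl | htop
  · have hq : q⁻¹ = 1 := by simpa using hpq
    rw [PiLp.norm_toLp, hq]
    have h1 := (le_abs_self _).trans (norm_le_pi_norm u i)
    have h2 := (le_abs_self _).trans (norm_le_pi_norm u j)
    norm_num
    linarith
  · have hp1 : 1 ≤ p.toReal := by
      rw [← ENNReal.toReal_one]
      exact (ENNReal.toReal_le_toReal ENNReal.one_ne_top htop).2 hp
    have hp0 : 0 < p.toReal := by linarith
    have hpinv : p⁻¹ ≠ ⊤ := ENNReal.inv_ne_top.2 (by positivity)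
    have hqinv : q⁻¹ ≠ ⊤ := ne_top_of_le_ne_top ENNReal.one_ne_top (hpq ▸ le_add_self)
    have hq : (q⁻¹).toReal = (p.toReal - 1) * (1 / p.toReal) := by
      have h := congrArg ENNReal.toReal hpq
      rw [ENNReal.toReal_add hpinv hqinv, ENNReal.toReal_inv, ENNReal.toReal_one] at h
      field_simp at h ⊢
      linarith
    have hconv : (u i + u j) ^ p.toReal ≤
        2 ^ (p.toReal - 1) * (u i ^ p.toReal + u j ^ p.toReal) := by
      have h := NNReal.rpow_add_le_mul_rpow_add_rpow ⟨u i, hu i⟩ ⟨u j, hu j⟩ hp1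
      exact_mod_cast h
    have hsum : u i ^ p.toReal + u j ^ p.toReal ≤ ∑ k, ‖u k‖ ^ p.toReal := by
      rw [← Finset.sum_pair (f := fun k => u k ^ p.toReal) hij]
      calc ∑ k ∈ {i, j}, u k ^ p.toReal = ∑ k ∈ {i, j}, ‖u k‖ ^ p.toReal :=
            sum_congr rfl fun k _ => by rw [Real.norm_of_nonneg (hu k)]
        _ ≤ ∑ k, ‖u k‖ ^ p.toReal :=
            sum_le_sum_of_subset_of_nonneg (subset_univ _) fun k _ _ => by positivity
    have hs : 0 ≤ u i + u j := add_nonneg (hu i) (hu j)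
    rw [PiLp.norm_eq_sum hp0, hq, Real.rpow_mul zero_le_two,
      ← Real.mul_rpow (by positivity) (sum_nonneg fun k _ => by positivity)]
    calc u i + u j = ((u i + u j) ^ p.toReal) ^ (1 / p.toReal) := by
          rw [← Real.rpow_mul hs, mul_one_div_cancel hp0.ne', Real.rpow_one]
      _ ≤ _ := by
          refine Real.rpow_le_rpow (by positivity) (hconv.trans ?_) (by positivity)
          gcongr

section Weierstrass

variable {n : ℕ} {K : Type*} [NormedField K]

lemma dmin_le (x : Fin n → K) {i j : Fin n} (hij : i ≠ j) : dmin x i ≤ ‖x i - x j‖ := by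
  have hj : j ∈ univ.erase i := mem_erase.2 ⟨hij.symm, mem_univ j⟩
  rw [dmin, dif_pos ⟨j, hj⟩]
  exact inf'_le _ hj

lemma erase_univ_nonempty (hn : 2 ≤ n) (i : Fin n) : (univ.erase i).Nonempty := by
  rw [← card_pos, card_erase_of_mem (mem_univ i), card_univ, Fintype.card_fin]
  omega

lemma le_dmin (hn : 2 ≤ n) {x : Fin n → K} {i : Fin n} {c : ℝ}
    (h : ∀ j, i ≠ j → c ≤ ‖x i - x j‖) : c ≤ dmin x i := by
  rw [dmin, dif_pos (erase_univ_nonempty hn i)]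
  exact le_inf' _ _ fun j hj => h j (ne_of_mem_erase hj).symm

lemma dmin_pos (hn : 2 ≤ n) {x : Fin n → K} (hx : Function.Injective x) (i : Fin n) :
    0 < dmin x i := by
  rw [dmin, dif_pos (erase_univ_nonempty hn i), lt_inf'_iff]
  exact fun j hj => norm_pos_iff.2 (sub_ne_zero.2 (hx.ne (ne_of_mem_erase hj).symm))

lemma norm_Wc_div_dmin_nonneg (hn : 2 ≤ n) (f : Polynomial K) {x : Fin n → K}
    (hx : Function.Injective x) (i : Fin n) : 0 ≤ ‖Wc f x i‖ / dmin x i :=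
  div_nonneg (norm_nonneg _) (dmin_pos hn hx i).le

lemma Ef_eq (p : ENNReal) (f : Polynomial K) (x : Fin n → K) :
    Ef p f x = ‖WithLp.toLp p fun i => ‖Wc f x i‖ / dmin x i‖ := rfl

lemma Ef_nonneg (p : ENNReal) [Fact (1 ≤ p)] (f : Polynomial K) (x : Fin n → K) :
    0 ≤ Ef p f x := norm_nonneg (WithLp.toLp p fun i => ‖Wc f x i‖ / dmin x i)

lemma Wc_eq_zero_of_Ef_eq_zero (hn : 2 ≤ n) (p : ENNReal) [Fact (1 ≤ p)] (f : Polynomial K)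
    {x : Fin n → K} (hx : Function.Injective x) (h : Ef p f x = 0) (i : Fin n) :
    Wc f x i = 0 := by
  have h0 : (WithLp.toLp p fun i => ‖Wc f x i‖ / dmin x i) = 0 := norm_eq_zero.1 h
  have hi : ‖Wc f x i‖ / dmin x i = 0 := congrFun (congrArg WithLp.ofLp h0) i
  rcases div_eq_zero_iff.1 hi with h1 | h1
  · exact norm_eq_zero.1 h1
  · exact absurd h1 (dmin_pos hn hx i).ne'

/-- Lagrange interpolation at pairwise distinct nodes, in terms of Weierstrass corrections. -/
lemma eq_prod_add_sum_Wc {f : Polynomial K} (hdeg : f.degree = (n : ℕ)) {x : Fin n → K}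
    (hx : Function.Injective x) :
    f = C f.leadingCoeff * ∏ i, (X - C (x i)) +
      ∑ i, C (f.leadingCoeff * Wc f x i) * ∏ j ∈ univ.erase i, (X - C (x j)) := by
  have hf : f ≠ 0 := by
    rintro rfl
    simp at hdeg
  have hc : f.leadingCoeff ≠ 0 := leadingCoeff_ne_zero.2 hf
  have hP : (∏ i, (X - C (x i))).degree = (n : WithBot ℕ) := by simp [degree_prod]
  have hmonic : (∏ i, (X - C (x i))).Monic := monic_prod_of_monic _ _ fun i _ => monic_X_sub_C _
  rw [← sub_eq_iff_eq_add']
  refine Polynomial.eq_of_degrees_lt_of_eval_index_eq univ (hx.injOn) ?_ ?_ fun i _ => ?_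
  · rw [card_univ, Fintype.card_fin, ← hdeg]
    refine degree_sub_lt_left ?_ hf ?_
    · rw [degree_C_mul hc, hP, hdeg]
    · rw [leadingCoeff_mul, leadingCoeff_C, hmonic.leadingCoeff, mul_one]
  · rw [card_univ, Fintype.card_fin]
    refine (degree_sum_le _ _).trans_lt ((Finset.sup_lt_iff (WithBot.bot_lt_coe n)).2 ?_)
    intro i _
    refine (Polynomial.degree_mul_le _ _).trans_lt ((add_le_of_nonpos_left degree_C_le).trans_lt ?_)
    rw [degree_prod]
    have := i.pos
    simp only [degree_X_sub_C, sum_const, card_erase_of_mem (mem_univ i), card_univ,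
      Fintype.card_fin, nsmul_eq_mul, mul_one]
    exact WithBot.coe_lt_coe.2 (Nat.cast_lt.2 (Nat.sub_lt this one_pos))
  · have hprod : ∏ j ∈ univ.erase i, (x i - x j) ≠ 0 :=
      prod_ne_zero_iff.2 fun j hj => sub_ne_zero.2 (hx.ne (ne_of_mem_erase hj).symm)
    have h0 : ∏ j, (x i - x j) = 0 := prod_eq_zero (mem_univ i) (sub_self _)
    simp only [eval_sub, eval_mul, eval_C, eval_prod, eval_X, eval_finsetSum]
    rw [h0, mul_zero, sub_zero, sum_eq_single i]
    · rw [Wc]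
      field_simp
    · intro j _ hji
      rw [prod_eq_zero (mem_erase.2 ⟨hji.symm, mem_univ i⟩) (sub_self _), mul_zero]
    · simp

lemma continuous_coeff_prod_X_sub_C (s : Finset (Fin n)) (d : ℕ) :
    Continuous fun x : Fin n → K => (∏ i ∈ s, (X - C (x i))).coeff d := by
  induction s using Finset.induction_on generalizing d with
  | empty => simpa using continuous_const
  | insert a s ha ih =>
    simp only [prod_insert ha, coeff_mul, coeff_sub, coeff_X, coeff_C]
    refine continuous_finsetSum _ fun e _ => Continuous.mul ?_ (ih _)
    split_ifs <;> fun_prop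

lemma isRootVector_of_tendsto {f : Polynomial K} (hdeg : f.degree = (n : ℕ))
    {x : ℕ → Fin n → K} (hx : ∀ k, Function.Injective (x k)) {ξ : Fin n → K}
    (hlim : Tendsto x atTop (nhds ξ))
    (hW : ∀ i, Tendsto (fun k => Wc f (x k) i) atTop (nhds 0)) : IsRootVector f ξ := by
  ext d
  have hprod : ∀ s : Finset (Fin n), Tendsto (fun k => (∏ i ∈ s, (X - C (x k i))).coeff d) atTop
      (nhds ((∏ i ∈ s, (X - C (ξ i))).coeff d)) := fun s =>
    ((continuous_coeff_prod_X_sub_C s d).tendsto ξ).comp hlim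
  have hconst : ∀ k, f.coeff d = f.leadingCoeff * (∏ i, (X - C (x k i))).coeff d +
      ∑ i, f.leadingCoeff * Wc f (x k) i * (∏ j ∈ univ.erase i, (X - C (x k j))).coeff d := by
    intro k
    have h := congrArg (fun g => g.coeff d) (eq_prod_add_sum_Wc hdeg (hx k))
    simpa only [coeff_add, finsetSum_coeff, coeff_C_mul] using h
  have hT : Tendsto (fun k => f.leadingCoeff * (∏ i, (X - C (x k i))).coeff d +
      ∑ i, f.leadingCoeff * Wc f (x k) i * (∏ j ∈ univ.erase i, (X - C (x k j))).coeff d) atTop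
      (nhds (f.leadingCoeff * (∏ i, (X - C (ξ i))).coeff d +
      ∑ i, f.leadingCoeff * 0 * (∏ j ∈ univ.erase i, (X - C (ξ j))).coeff d)) :=
    ((hprod univ).const_mul _).add
      (tendsto_finsetSum _ fun i _ => ((hW i).const_mul _).mul (hprod _))
  have h := tendsto_nhds_unique (tendsto_const_nhds.congr hconst) hT
  simpa using h

/-- Moving each node by at most `g` times its Weierstrass correction shrinks distances between
nodes by at most the factor `1 - b E g`. -/
lemma mul_norm_sub_le_norm_sub (hn : 2 ≤ n) {f : Polynomial K} {p q : ENNReal} [Fact (1 ≤ p)]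
    (hpq : p⁻¹ + q⁻¹ = 1) {x y : Fin n → K} (hx : Function.Injective x) {g : ℝ} (hg : 0 ≤ g)
    (hxy : ∀ i, ‖x i - y i‖ ≤ g * ‖Wc f x i‖) {i j : Fin n} (hij : i ≠ j) :
    (1 - (2 : ℝ) ^ (ENNReal.toReal q⁻¹) * Ef p f x * g) * ‖x i - x j‖ ≤ ‖y i - y j‖ := by
  have hW : ∀ i j, i ≠ j → ‖Wc f x i‖ ≤ ‖Wc f x i‖ / dmin x i * ‖x i - x j‖ := by
    intro i j hij
    calc ‖Wc f x i‖ = ‖Wc f x i‖ / dmin x i * dmin x i :=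
          (div_mul_cancel₀ _ (dmin_pos hn hx i).ne').symm
      _ ≤ _ := mul_le_mul_of_nonneg_left (dmin_le x hij) (norm_Wc_div_dmin_nonneg hn f hx i)
  have hH := PiLp.add_le_two_rpow_mul_norm p q hpq (norm_Wc_div_dmin_nonneg hn f hx) hij
  rw [← Ef_eq] at hH
  have h1 := hW i j hij
  have h2 := hW j i hij.symm
  rw [norm_sub_rev (x j)] at h2
  have h3 : ‖x i - x j‖ ≤ ‖x i - y i‖ + ‖y i - y j‖ + ‖x j - y j‖ := by
    calc ‖x i - x j‖ = ‖(x i - y i) + (y i - y j) - (x j - y j)‖ := by congr 1; ring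
      _ ≤ _ := (norm_sub_le _ _).trans (by gcongr; exact norm_add_le _ _)
  have h4 : g * (‖Wc f x i‖ + ‖Wc f x j‖) ≤
      g * ((2 : ℝ) ^ (ENNReal.toReal q⁻¹) * Ef p f x * ‖x i - x j‖) := by
    refine mul_le_mul_of_nonneg_left ?_ hg
    refine (add_le_add h1 h2).trans ?_
    rw [← add_mul]
    exact mul_le_mul_of_nonneg_right hH (norm_nonneg _)
  have := hxy i
  have := hxy j
  linarith

lemma Ef_le_mul_Ef (hn : 2 ≤ n) {f : Polynomial K} (p : ENNReal) [Fact (1 ≤ p)]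
    {x y : Fin n → K} (hx : Function.Injective x) (hy : Function.Injective y) {ψ B : ℝ}
    (hψ : 0 < ψ) (hB : 0 ≤ B) (hxy : ∀ i j, i ≠ j → ψ * ‖x i - x j‖ ≤ ‖y i - y j‖)
    (hW : ∀ i, ‖Wc f y i‖ ≤ B * ‖Wc f x i‖) : Ef p f y ≤ B / ψ * Ef p f x := by
  have hsmul : B / ψ * Ef p f x =
      ‖WithLp.toLp p fun i => B / ψ * (‖Wc f x i‖ / dmin x i)‖ := by
    rw [Ef_eq, ← Real.norm_of_nonneg (div_nonneg hB hψ.le), ← norm_smul,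
      Real.norm_of_nonneg (div_nonneg hB hψ.le)]
    rfl
  rw [hsmul, Ef_eq]
  refine PiLp.norm_toLp_le_of_le p (norm_Wc_div_dmin_nonneg hn f hy) fun i => ?_
  rw [div_mul_div_comm]
  refine div_le_div₀ (by positivity) (hW i) (mul_pos hψ (dmin_pos hn hx i)) ?_
  refine le_dmin hn fun j hij => le_trans ?_ (hxy i j hij)
  exact mul_le_mul_of_nonneg_left (dmin_le x hij) hψ.le

end Weierstrass

lemma mul_geom_sum_add_one (m : ℝ) (k : ℕ) :
    (∑ i ∈ range k, (m + 1) ^ i) * m + 1 = (m + 1) ^ k := by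
  have := geom_sum_mul (m + 1) k
  rw [add_sub_cancel_right] at this
  linarith

lemma geom_sum_add_ge {r : ℝ} (hr : 1 ≤ r) (k j : ℕ) :
    ∑ i ∈ range k, r ^ i + r ^ k * j ≤ ∑ i ∈ range (k + j), r ^ i := by
  rw [sum_range_add]
  gcongr
  calc r ^ k * j = ∑ _i ∈ range j, r ^ k := by simp [mul_comm]
    _ ≤ _ := sum_le_sum fun i _ => pow_le_pow_right₀ hr (Nat.le_add_right k i)

/-- Proinov, Theorem 2.2 (ii). -/
theorem stmt_7 {n : ℕ} {K : Type*} [NormedField K] [CompleteSpace K] (hn : 2 ≤ n)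
    (f : Polynomial K) (hdeg : f.degree = (n : ℕ))
    (p q : ENNReal) (hp : 1 ≤ p) (hpq : p⁻¹ + q⁻¹ = 1)
    (b : ℝ) (hb : b = (2 : ℝ) ^ (ENNReal.toReal q⁻¹))
    (D : Set (Fin n → K)) (T : (Fin n → K) → Fin n → K)
    (τ : ℝ) (hτ : 0 < τ) (m : ℝ) (hm : 0 ≤ m)
    (β γ : ℝ → ℝ)
    (hβ0 : ∀ t, 0 ≤ t → t < τ → 0 ≤ β t)
    (hβmono : ∀ s t, 0 ≤ s → s ≤ t → t < τ → β s ≤ β t)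
    (hβqh : ∀ l t, 0 ≤ l → l ≤ 1 → 0 ≤ t → t < τ → β (l * t) ≤ l ^ m * β t)
    (hγpos : ∀ t, 0 ≤ t → t < τ → 0 < γ t)
    (hγmono : ∀ s t, 0 ≤ s → s ≤ t → t < τ → γ s ≤ γ t)
    (hψ : ∀ t, 0 ≤ t → t < τ → 0 < 1 - b * t * γ t)
    (habc : ∀ x : Fin n → K, Function.Injective x → Ef p f x < τ →
      x ∈ D ∧ (∀ i, ‖x i - T x i‖ ≤ γ (Ef p f x) * ‖Wc f x i‖) ∧
        (∀ i, ‖Wc f (T x) i‖ ≤ β (Ef p f x) * ‖Wc f x i‖))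
    (x0 : Fin n → K) (hx0 : Function.Injective x0) (hE0 : Ef p f x0 < τ)
    (hφ : β (Ef p f x0) / (1 - b * Ef p f x0 * γ (Ef p f x0)) ≤ 1)
    (lam θ : ℝ)
    (hlam : lam = β (Ef p f x0) / (1 - b * Ef p f x0 * γ (Ef p f x0)))
    (hθ : θ = 1 - b * Ef p f x0 * γ (Ef p f x0))
    (S : ℕ → ℝ) (hS : ∀ k, S k = ∑ i ∈ Finset.range k, (m + 1) ^ i) :
    ∃ ξ : Fin n → K, IsRootVector f ξ ∧
      Tendsto (fun k => T^[k] x0) atTop (nhds ξ) ∧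
      ∀ k : ℕ, ∀ i, ‖T^[k] x0 i - ξ i‖ ≤
        γ (Ef p f x0 * lam ^ S k) *
          (θ ^ k * lam ^ S k / (1 - θ * lam ^ ((m + 1) ^ k))) * ‖Wc f x0 i‖ := by
  have : Fact (1 ≤ p) := ⟨hp⟩
  set e := Ef p f x0 with he
  have he0 : 0 ≤ e := Ef_nonneg p f x0
  have hb0 : 0 < b := hb ▸ Real.rpow_pos_of_pos two_pos _
  have hθ0 : 0 < θ := hθ ▸ hψ e he0 hE0
  have hlam0 : 0 ≤ lam := by
    rw [hlam, ← hθ]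
    exact div_nonneg (hβ0 e he0 hE0) hθ0.le
  have hlam1 : lam ≤ 1 := hlam ▸ hφ
  have hβe : β e = θ * lam := by
    rw [hlam, ← hθ, mul_div_cancel₀ _ hθ0.ne']
  have hS0 : ∀ k, 0 ≤ S k := fun k => hS k ▸ sum_nonneg fun i _ => by positivity
  have hSsucc : ∀ k, S (k + 1) = S k + (m + 1) ^ k := fun k => by
    rw [hS, hS, sum_range_succ]
  have hlamS0 : ∀ s : ℝ, 0 ≤ lam ^ s := fun s => Real.rpow_nonneg hlam0 s
  have hlamS1 : ∀ k, lam ^ S k ≤ 1 := fun k => Real.rpow_le_one hlam0 hlam1 (hS0 k)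
  have hElt : ∀ k, e * lam ^ S k < τ := fun k =>
    (mul_le_of_le_one_right he0 (hlamS1 k)).trans_lt hE0
  set x : ℕ → Fin n → K := fun k => T^[k] x0 with hxdef
  have hxsucc : ∀ k, x (k + 1) = T (x k) := fun k => Function.iterate_succ_apply' T k x0
  have key : ∀ k, Function.Injective (x k) ∧ Ef p f (x k) ≤ e * lam ^ S k ∧
      ∀ i, ‖Wc f (x k) i‖ ≤ θ ^ k * lam ^ S k * ‖Wc f x0 i‖ := by
    intro k
    induction k with
    | zero => simp [hS, hxdef, hx0, he]
    | succ k ih =>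
      obtain ⟨hinj, hE, hW⟩ := ih
      have hEτ := hE.trans_lt (hElt k)
      have hE0' := Ef_nonneg p f (x k)
      have hEe : Ef p f (x k) ≤ e := hE.trans (mul_le_of_le_one_right he0 (hlamS1 k))
      obtain ⟨-, hstep, hWstep⟩ := habc (x k) hinj hEτ
      rw [← hxsucc] at hstep hWstep
      have hγ0 := (hγpos _ hE0' hEτ).le
      have hψk := hψ _ hE0' hEτ
      have hθψ : θ ≤ 1 - b * Ef p f (x k) * γ (Ef p f (x k)) := by
        rw [hθ]
        have := hγmono _ _ hE0' hEe hE0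
        gcongr
      have hdist : ∀ i j, i ≠ j → (1 - b * Ef p f (x k) * γ (Ef p f (x k))) *
          ‖x k i - x k j‖ ≤ ‖x (k + 1) i - x (k + 1) j‖ := fun i j hij => by
        rw [hb]
        exact mul_norm_sub_le_norm_sub hn hpq hinj hγ0 hstep hij
      have hinj' : Function.Injective (x (k + 1)) := by
        intro i j hij
        by_contra hne
        have h := hdist i j hne
        rw [hij, sub_self, norm_zero] at h
        have : 0 < ‖x k i - x k j‖ := norm_pos_iff.2 (sub_ne_zero.2 (hinj.ne hne))
        exact absurd h (not_le.2 (mul_pos hψk this))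
      have hβk : β (Ef p f (x k)) ≤ θ * lam ^ ((m + 1) ^ k) := by
        calc β (Ef p f (x k)) ≤ β (lam ^ S k * e) :=
              hβmono _ _ hE0' (by rwa [mul_comm]) (by rw [mul_comm]; exact hElt k)
          _ ≤ (lam ^ S k) ^ m * β e := hβqh _ _ (hlamS0 _) (hlamS1 k) he0 hE0
          _ = θ * lam ^ ((m + 1) ^ k) := by
              rw [hβe, ← Real.rpow_mul hlam0, ← mul_geom_sum_add_one m k, ← hS,
                Real.rpow_add_of_nonneg hlam0 (mul_nonneg (hS0 k) hm) zero_le_one,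
                Real.rpow_one]
              ring
      have hSk : lam ^ S (k + 1) = lam ^ S k * lam ^ ((m + 1) ^ k) := by
        rw [hSsucc, Real.rpow_add_of_nonneg hlam0 (hS0 k) (by positivity)]
      refine ⟨hinj', ?_, fun i => ?_⟩
      · have hφk : β (Ef p f (x k)) / (1 - b * Ef p f (x k) * γ (Ef p f (x k))) ≤
            lam ^ ((m + 1) ^ k) := by
          rw [div_le_iff₀ hψk]
          refine hβk.trans ?_
          rw [mul_comm]
          exact mul_le_mul_of_nonneg_left hθψ (hlamS0 _)
        calc Ef p f (x (k + 1)) ≤ _ * Ef p f (x k) :=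
              Ef_le_mul_Ef hn p hinj hinj' hψk (hβ0 _ hE0' hEτ) hdist hWstep
          _ ≤ lam ^ ((m + 1) ^ k) * (e * lam ^ S k) :=
              mul_le_mul hφk hE hE0' (hlamS0 _)
          _ = e * lam ^ S (k + 1) := by rw [hSk]; ring
      · calc ‖Wc f (x (k + 1)) i‖ ≤ β (Ef p f (x k)) * ‖Wc f (x k) i‖ := hWstep i
          _ ≤ (θ * lam ^ ((m + 1) ^ k)) * (θ ^ k * lam ^ S k * ‖Wc f x0 i‖) :=
              mul_le_mul hβk (hW i) (norm_nonneg _) (mul_nonneg hθ0.le (hlamS0 _))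
          _ = θ ^ (k + 1) * lam ^ S (k + 1) * ‖Wc f x0 i‖ := by rw [hSk, pow_succ]; ring
  have hstep : ∀ k i, ‖x k i - x (k + 1) i‖ ≤
      γ (e * lam ^ S k) * (θ ^ k * lam ^ S k * ‖Wc f x0 i‖) := by
    intro k i
    obtain ⟨hinj, hE, hW⟩ := key k
    have hEτ := hE.trans_lt (hElt k)
    rw [hxsucc]
    refine ((habc (x k) hinj hEτ).2.1 i).trans ?_
    exact mul_le_mul (hγmono _ _ (Ef_nonneg p f _) hE (hElt k)) (hW i) (norm_nonneg _)
      (hγpos _ (mul_nonneg he0 (hlamS0 _)) (hElt k)).le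
  rcases he0.eq_or_lt with hzero | hepos
  · have hW0 : ∀ i, Wc f x0 i = 0 := Wc_eq_zero_of_Ef_eq_zero hn p f hx0 hzero.symm
    have hfix : ∀ k, x k = x0 := by
      intro k
      induction k with
      | zero => rfl
      | succ k ih =>
        rw [← ih]
        ext i
        have h := hstep k i
        rw [hW0, norm_zero, mul_zero, mul_zero] at h
        exact (sub_eq_zero.1 (norm_le_zero_iff.1 h)).symm
    have hlim : Tendsto x atTop (nhds x0) :=
      tendsto_const_nhds.congr fun k => (hfix k).symm
    refine ⟨x0, isRootVector_of_tendsto hdeg (fun k => (key k).1) hlim fun i => ?_, hlim,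
      fun k i => ?_⟩
    · exact tendsto_const_nhds.congr fun k => by rw [hfix k, hW0 i]
    · change ‖x k i - x0 i‖ ≤ _
      rw [hfix, hW0, sub_self, norm_zero, mul_zero]
  · have hθ1 : θ < 1 := by
      rw [hθ]
      linarith [mul_pos (mul_pos hb0 hepos) (hγpos e he0 hE0)]
    have hratio : ∀ k : ℕ, θ * lam ^ ((m + 1) ^ k) < 1 := fun k =>
      (mul_le_of_le_one_right hθ0.le
        (Real.rpow_le_one hlam0 hlam1 (by positivity))).trans_lt hθ1
    have hgeom : ∀ k i j, dist (x (k + j) i) (x (k + (j + 1)) i) ≤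
        γ (e * lam ^ S k) * (θ ^ k * lam ^ S k) * ‖Wc f x0 i‖ *
          (θ * lam ^ ((m + 1) ^ k)) ^ j := by
      intro k i j
      have hSkj : S k + (m + 1) ^ k * j ≤ S (k + j) := by
        rw [hS, hS]
        exact geom_sum_add_ge (by linarith) k j
      have hlamle : lam ^ S (k + j) ≤ lam ^ S k * (lam ^ ((m + 1) ^ k)) ^ j := by
        rw [← Real.rpow_mul_natCast hlam0,
          ← Real.rpow_add_of_nonneg hlam0 (hS0 k) (by positivity)]
        exact Real.rpow_le_rpow_of_exponent_ge' hlam0 hlam1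
          (add_nonneg (hS0 k) (by positivity)) hSkj
      have hlamle' : lam ^ S (k + j) ≤ lam ^ S k :=
        Real.rpow_le_rpow_of_exponent_ge' hlam0 hlam1 (hS0 k)
          (le_trans (le_add_of_nonneg_right (by positivity)) hSkj)
      have hγle : γ (e * lam ^ S (k + j)) ≤ γ (e * lam ^ S k) :=
        hγmono _ _ (mul_nonneg he0 (hlamS0 _)) (by gcongr) (hElt k)
      have hγ0 := (hγpos _ (mul_nonneg he0 (hlamS0 (S k))) (hElt k)).le
      rw [dist_eq_norm]
      calc ‖x (k + j) i - x (k + j + 1) i‖ ≤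
            γ (e * lam ^ S (k + j)) * (θ ^ (k + j) * lam ^ S (k + j) * ‖Wc f x0 i‖) :=
              hstep (k + j) i
        _ ≤ γ (e * lam ^ S k) * (θ ^ (k + j) * (lam ^ S k * (lam ^ ((m + 1) ^ k)) ^ j) *
              ‖Wc f x0 i‖) := by
              have := hlamS0 (S (k + j))
              gcongr
        _ = _ := by rw [pow_add, mul_pow]; ring
    have hcauchy : ∀ i, ∃ a, Tendsto (fun k => x k i) atTop (nhds a) := fun i =>
      cauchySeq_tendsto_of_complete <| cauchySeq_of_le_geometric _ _ (hratio 0) fun j => by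
        have h := hgeom 0 i j
        rw [zero_add, zero_add] at h
        exact h
    choose ξ hξ using hcauchy
    have hlim : Tendsto x atTop (nhds ξ) := tendsto_pi_nhds.2 hξ
    refine ⟨ξ, isRootVector_of_tendsto hdeg (fun k => (key k).1) hlim fun i => ?_, hlim,
      fun k i => ?_⟩
    · refine squeeze_zero_norm (a := fun k => θ ^ k * ‖Wc f x0 i‖) (fun k => ?_) ?_
      · refine ((key k).2.2 i).trans ?_
        gcongr
        exact mul_le_of_le_one_right (by positivity) (hlamS1 k)
      · simpa using (tendsto_pow_atTop_nhds_zero_of_lt_one hθ0.le hθ1).mul_const ‖Wc f x0 i‖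
    · have hshift : Tendsto (fun j => x (k + j) i) atTop (nhds (ξ i)) := by
        simpa only [add_comm k] using (tendsto_add_atTop_iff_nat k).2 (hξ i)
      have h := dist_le_of_le_geometric_of_tendsto₀ _ _ (hratio k) (hgeom k i) hshift
      rw [dist_eq_norm] at h
      refine h.trans_eq ?_
      ring
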